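/- For all non-negative integers n and j with j ≤ n and every natural number t ≥ 1, the central binomial coefficient binom(2n,n) divides M_S(2n,j,t). -/

import Mathlib

/-- Catalan triangle number `C(N,k) = binom(N+k,N) - binom(N+k,N+1)`. -/
def catT (N k : ℕ) : ℤ := ((N + k).choose N : ℤ) - ((N + k).choose (N + 1) : ℤ)

/-- `F(2n,k) = (-1)^k C(2n,k) C(2n,2n-k)`. -/
def F (n k : ℕ) : ℤ := (-1) ^ k * catT (2 * n) k * catT (2 * n) (2 * n - k)

/-- The M sum
`M_S(2n,j,t) = binom(2n-j,j) * Σ_{v=0}^{2n-2j} binom(2n-2j,v) binom(2n,j+v)^t F(2n,j+v)`. -/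
def MS (n j t : ℕ) : ℤ :=
  ((2 * n - j).choose j : ℤ) *
    ∑ v ∈ Finset.range (2 * n - 2 * j + 1),
      ((2 * n - 2 * j).choose v : ℤ) * ((2 * n).choose (j + v) : ℤ) ^ t * F n (j + v)

section

open Finset Nat

/-- The alternating central difference of order `2m` of `P` at the origin. -/
def centralDiff (m : ℕ) (P : ℚ → ℚ) : ℚ :=
  ∑ i ∈ range (2 * m + 1), (-1) ^ (i + m) * ((2 * m).choose i : ℚ) * P ((i : ℚ) - m)

/-- The even polynomial `∏_{a = 1}^{s} ((b + a)² - x²)`. -/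
def evenProd (b s : ℕ) (x : ℚ) : ℚ := ∏ a ∈ range s, (((b : ℚ) + 1 + a) ^ 2 - x ^ 2)

lemma choose_mul_mul_sub (m i : ℕ) :
    ((2 * m + 2).choose (i + 1) : ℚ) * ((i + 1) * (2 * m + 1 - i)) =
      (2 * m + 2) * (2 * m + 1) * ((2 * m).choose i : ℚ) := by
  have h1 : ((2 * m + 2).choose (i + 1) : ℚ) * (i + 1) = (2 * m + 2) * ((2 * m + 1).choose i) := by
    have := Nat.add_one_mul_choose_eq (2 * m + 1) i
    exact_mod_cast this.symm
  have h2 : ((2 * m + 1).choose i : ℚ) * (2 * m + 1 - i) = (2 * m + 1) * ((2 * m).choose i) := by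
    rcases le_or_gt i (2 * m + 1) with hi | hi
    · have := Nat.choose_mul_succ_eq (2 * m) i
      have h3 : ((2 * m + 1 - i : ℕ) : ℚ) = 2 * m + 1 - i := by
        rw [Nat.cast_sub hi]; push_cast; ring
      rw [← h3]
      have h4 : ((2 * m).choose i : ℚ) * (2 * m + 1) =
        ((2 * m + 1).choose i) * ((2 * m + 1 - i : ℕ) : ℚ) := by exact_mod_cast this
      rw [← h4]; ring
    · rw [Nat.choose_eq_zero_of_lt hi, Nat.choose_eq_zero_of_lt (by omega)]; simp
  linear_combination (2 * (m : ℚ) + 1 - i) * h1 + (2 * (m : ℚ) + 2) * h2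

lemma centralDiff_zero (P : ℚ → ℚ) : centralDiff 0 P = P 0 := by
  simp [centralDiff]

lemma centralDiff_succ_sq_sub (m : ℕ) (P : ℚ → ℚ) :
    centralDiff (m + 1) (fun x => (((m : ℚ) + 1) ^ 2 - x ^ 2) * P x) =
      (2 * m + 2) * (2 * m + 1) * centralDiff m P := by
  unfold centralDiff
  rw [show 2 * (m + 1) + 1 = (2 * m + 1 + 1) + 1 by ring, sum_range_succ', sum_range_succ, mul_sum]
  have e : ∀ i : ℕ, (-1 : ℚ) ^ (i + 1 + (m + 1)) * ((2 * (m + 1)).choose (i + 1) : ℚ) *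
      ((((m : ℚ) + 1) ^ 2 - (((i + 1 : ℕ) : ℚ) - ((m + 1 : ℕ) : ℚ)) ^ 2) *
        P (((i + 1 : ℕ) : ℚ) - ((m + 1 : ℕ) : ℚ))) =
      (2 * m + 2) * (2 * m + 1) *
        ((-1) ^ (i + m) * ((2 * m).choose i : ℚ) * P ((i : ℚ) - m)) := by
    intro i
    have h := choose_mul_mul_sub m i
    rw [show 2 * (m + 1) = 2 * m + 2 by ring,
      show (((i + 1 : ℕ) : ℚ) - ((m + 1 : ℕ) : ℚ)) = (i : ℚ) - m by push_cast; ring]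
    have h' : (-1 : ℚ) ^ (i + 1 + (m + 1)) = (-1) ^ (i + m) := by
      rw [show i + 1 + (m + 1) = i + m + 2 by ring, pow_add]; norm_num
    rw [h']
    linear_combination ((-1 : ℚ) ^ (i + m) * P ((i : ℚ) - m)) * h
  rw [sum_congr rfl (fun i _ => e i), e (2 * m + 1)]
  have h0 : ((m : ℚ) + 1) ^ 2 - (((0 : ℕ) : ℚ) - ((m + 1 : ℕ) : ℚ)) ^ 2 = 0 := by push_cast; ring
  simp only [h0]
  simp

lemma centralDiff_sq_sub_mul (m : ℕ) (c : ℚ) (P : ℚ → ℚ) :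
    centralDiff m (fun x => (c ^ 2 - x ^ 2) * P x) =
      (c ^ 2 - m ^ 2) * centralDiff m P +
        centralDiff m (fun x => ((m : ℚ) ^ 2 - x ^ 2) * P x) := by
  unfold centralDiff
  rw [mul_sum, ← sum_add_distrib]
  refine sum_congr rfl fun i _ => ?_
  ring

lemma evenProd_succ (b s : ℕ) :
    evenProd b (s + 1) = fun x => (((b : ℚ) + 1 + s) ^ 2 - x ^ 2) * evenProd b s x := by
  funext x
  rw [evenProd, prod_range_succ, mul_comm, evenProd]

lemma centralDiff_evenProd_succ (b m s : ℕ) :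
    centralDiff (m + 1) (evenProd b (s + 1)) =
      (((b : ℚ) + 1 + s) ^ 2 - (m + 1) ^ 2) * centralDiff (m + 1) (evenProd b s) +
        (2 * m + 2) * (2 * m + 1) * centralDiff m (evenProd b s) := by
  rw [evenProd_succ, centralDiff_sq_sub_mul, Nat.cast_succ, centralDiff_succ_sq_sub]

lemma centralDiff_evenProd_eq_zero (b s m : ℕ) (h : s < m) :
    centralDiff m (evenProd b s) = 0 := by
  induction s generalizing m with
  | zero =>
    have h0 := Int.alternating_sum_range_choose_of_ne (n := 2 * m) (by omega)
    have h1 : (∑ i ∈ range (2 * m + 1), (-1 : ℚ) ^ i * ((2 * m).choose i : ℚ)) = 0 := by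
      exact_mod_cast h0
    have h2 : centralDiff m (evenProd b 0) =
        (-1) ^ m * ∑ i ∈ range (2 * m + 1), (-1 : ℚ) ^ i * ((2 * m).choose i : ℚ) := by
      rw [centralDiff, mul_sum]
      refine sum_congr rfl fun i _ => ?_
      simp [evenProd, pow_add]; ring
    rw [h2, h1, mul_zero]
  | succ s ih =>
    obtain ⟨m, rfl⟩ : ∃ k, m = k + 1 := ⟨m - 1, by omega⟩
    rw [centralDiff_evenProd_succ, ih _ (by omega), ih _ (by omega)]; simp

/-- A form of Dixon's summation of a terminating well-poised `₃F₂`. -/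
lemma centralDiff_evenProd (b m d : ℕ) :
    centralDiff m (evenProd b (m + d)) =
      (2 * m)! * (m + d)! * (b + m + d)! * (b + d)! / (m ! * d ! * (b + m)! * b !) := by
  induction m generalizing d with
  | zero =>
    rw [centralDiff_zero]
    induction d with
    | zero => simp [evenProd]; field_simp
    | succ d ih =>
      rw [show 0 + (d + 1) = (0 + d) + 1 by ring, evenProd_succ]
      simp only [ih]
      simp only [← add_assoc, Nat.factorial_succ, Nat.add_zero, Nat.zero_add]
      push_cast
      field_simp
      ring
  | succ m ihm =>
    induction d with
    | zero =>
      have := ihm 0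
      rw [Nat.add_zero] at this
      rw [Nat.add_zero, centralDiff_evenProd_succ, centralDiff_evenProd_eq_zero _ _ _ (by omega), this]
      simp only [Nat.add_zero, show 2 * (m + 1) = 2 * m + 1 + 1 by ring,
        show b + (m + 1) = b + m + 1 by ring, Nat.factorial_succ]
      push_cast
      field_simp
      ring
    | succ d ihd =>
      have h := ihm (d + 1)
      rw [show m + 1 + (d + 1) = (m + 1 + d) + 1 by ring, centralDiff_evenProd_succ, ihd,
        show m + 1 + d = m + (d + 1) by ring, h]
      rw [show b + (m + 1) + (d + 1) = b + m + d + 1 + 1 by ring,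
        show b + (m + 1) + d = b + m + d + 1 by ring,
        show b + m + (d + 1) = b + m + d + 1 by ring,
        show b + (m + 1) = b + m + 1 by ring, show b + (d + 1) = b + d + 1 by ring,
        show m + (d + 1) = m + d + 1 by ring, show 2 * (m + 1) = 2 * m + 1 + 1 by ring]
      simp only [Nat.factorial_succ]
      push_cast
      field_simp
      ring

lemma factorial_mul_choose_eq_prod (n k : ℕ) :
    ((2 * n)! : ℚ) * ((2 * n + k).choose (2 * n) : ℚ) =
      ∏ a ∈ range (2 * n), ((n : ℚ) + 1 + a + (k - n)) := by
  have h := Nat.ascFactorial_eq_factorial_mul_choose k (2 * n)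
  have h2 := Nat.ascFactorial_eq_prod_range (k + 1) (2 * n)
  rw [h2, add_comm k (2 * n)] at h
  have h3 : (((∏ a ∈ range (2 * n), (k + 1 + a) : ℕ)) : ℚ) =
    ((2 * n)! : ℚ) * ((2 * n + k).choose (2 * n) : ℚ) := by exact_mod_cast h
  rw [← h3]
  push_cast
  refine prod_congr rfl fun a _ => ?_
  ring

lemma succ_mul_catT (N k : ℕ) :
    ((N : ℚ) + 1) * (catT N k : ℚ) = (N + 1 - k) * ((N + k).choose N : ℚ) := by
  have h := Nat.choose_succ_right_eq (N + k) N
  rw [Nat.add_sub_cancel_left] at h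
  have h' : ((N + k).choose (N + 1) : ℚ) * (N + 1) = (N + k).choose N * k := by exact_mod_cast h
  rw [catT]
  push_cast
  linear_combination -h'

lemma mul_F_eq (n k : ℕ) (hk : k ≤ 2 * n) :
    ((2 * (n : ℚ) + 1) * (2 * n)!) ^ 2 * (F n k : ℚ) =
      (-1) ^ k * ((((n : ℚ) + 1) ^ 2 - (k - n) ^ 2) * evenProd n (2 * n) (k - n)) := by
  have h1 := succ_mul_catT (2 * n) k
  have h2 := succ_mul_catT (2 * n) (2 * n - k)
  have h3 := factorial_mul_choose_eq_prod n k
  have h4 := factorial_mul_choose_eq_prod n (2 * n - k)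
  have h5 : evenProd n (2 * n) (k - n) =
      (((2 * n)! : ℚ) * ((2 * n + k).choose (2 * n) : ℚ)) *
        (((2 * n)! : ℚ) * ((2 * n + (2 * n - k)).choose (2 * n) : ℚ)) := by
    rw [h3, h4, ← prod_mul_distrib, evenProd]
    refine prod_congr rfl fun a _ => ?_
    rw [Nat.cast_sub hk]; push_cast; ring
  rw [h5, F]
  rw [Nat.cast_sub hk] at h2
  push_cast at h1 h2 ⊢
  calc _ = (-1) ^ k * ((2 * n)! : ℚ) ^ 2 * (((2 * (n : ℚ) + 1) * catT (2 * n) k) *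
        ((2 * (n : ℚ) + 1) * catT (2 * n) (2 * n - k))) := by ring
    _ = _ := by rw [h1, h2]; ring

lemma centralDiff_sq_sub_mul_evenProd (j m : ℕ) :
    (2 * (j : ℚ) + m + 1) *
      centralDiff m (fun x => (((j + m : ℕ) + 1 : ℚ) ^ 2 - x ^ 2) *
        evenProd (j + m) (2 * (j + m)) x) =
      (2 * (j + m) + 1) * (2 * (j + m) ^ 2 + (j + m) * (1 - j) + j + 1) *
        centralDiff m (evenProd (j + m) (2 * (j + m))) := by
  rw [centralDiff_sq_sub_mul]
  cases m with
  | zero =>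
    simp only [centralDiff_zero]
    push_cast
    ring
  | succ m =>
    rw [Nat.cast_succ m, centralDiff_succ_sq_sub]
    have h1 := centralDiff_evenProd (j + (m + 1)) (m + 1) (2 * j + m + 1)
    have h2 := centralDiff_evenProd (j + (m + 1)) m (2 * j + m + 2)
    rw [show m + 1 + (2 * j + m + 1) = 2 * (j + (m + 1)) by ring] at h1
    rw [show m + (2 * j + m + 2) = 2 * (j + (m + 1)) by ring] at h2
    have e1 : j + (m + 1) + (2 * j + m + 2) = (j + (m + 1) + (2 * j + m + 1)) + 1 := by ring
    have e2 : j + (m + 1) + m + (2 * j + m + 2) =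
      j + (m + 1) + (m + 1) + (2 * j + m + 1) := by ring
    have e3 : j + (m + 1) + (m + 1) = j + (m + 1) + m + 1 := by ring
    have e4 : 2 * j + m + 2 = (2 * j + m + 1) + 1 := by ring
    have key : (2 * m + 2) * (2 * m + 1) * centralDiff m (evenProd (j + (m + 1)) (2 * (j + (m + 1))))
        * (2 * j + m + 2) = (m + 1) * (j + 2 * m + 2) * (3 * j + 2 * m + 3) *
        centralDiff (m + 1) (evenProd (j + (m + 1)) (2 * (j + (m + 1)))) := by
      rw [h1, h2, e1, e2, e3, e4, show 2 * (m + 1) = 2 * m + 1 + 1 by ring]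
      simp only [Nat.factorial_succ]
      push_cast
      field_simp
      ring
    push_cast
    linear_combination key

lemma two_mul_succ_dvd_mul_choose (n j : ℕ) :
    2 * n + 1 ∣ j * (2 * n + j).choose j := by
  cases j with
  | zero => simp
  | succ i =>
    have h := Nat.choose_succ_right_eq (2 * n + (i + 1)) i
    rw [show 2 * n + (i + 1) - i = 2 * n + 1 by omega] at h
    exact ⟨(2 * n + (i + 1)).choose i, by rw [mul_comm, h, mul_comm]⟩

lemma two_mul_succ_dvd_choose_mul_choose (n j : ℕ) (hj : j ≤ n) :
    (2 * n + 1 : ℤ) ∣ (2 * n + j).choose j * (3 * n).choose (n + j + 1) := by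
  obtain ⟨q, hq⟩ : (2 * n + 1 : ℤ) ∣ j * (2 * n + j).choose j := by
    exact_mod_cast two_mul_succ_dvd_mul_choose n j
  have h1 := Nat.choose_mul_succ_eq (3 * n) (n + j + 1)
  have h2 := Nat.choose_mul_succ_eq (3 * n + 1) (n + j + 1)
  have e1 : 3 * n + 1 - (n + j + 1) = 2 * n - j := by omega
  have e2 : 3 * n + 1 + 1 - (n + j + 1) = 2 * n + 1 - j := by omega
  rw [e1] at h1
  rw [e2] at h2
  zify [show j ≤ 2 * n by omega, show j ≤ 2 * n + 1 by omega] at h1 h2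
  have hc : IsCoprime (2 * n + 1 : ℤ) ((3 * n + 1) * (3 * n + 2)) := by
    refine IsCoprime.mul_right ⟨3, -2, by ring⟩ ⟨-3, 2, by ring⟩
  refine hc.dvd_of_dvd_mul_left ⟨(2 * n - j) * (3 * n + 1 + 1).choose (n + j + 1) *
    ((2 * n + j).choose j - q), ?_⟩
  linear_combination ((2 * n + j).choose j : ℤ) * (3 * n + 2) * h1 +
    ((2 * n + j).choose j : ℤ) * (2 * n - j) * h2 -
    (2 * n - j) * ((3 * n + 1 + 1).choose (n + j + 1) : ℤ) * hq

lemma mul_dvd_choose_mul_choose_mul (n j : ℕ) (hj : j ≤ n) :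
    ((2 * n + 1) * (n + j + 1) : ℤ) ∣ (3 * n).choose (n + j) * (2 * n + j).choose j *
      (2 * n ^ 2 + n * (1 - j) + j + 1) := by
  obtain ⟨q, hq⟩ : (2 * n + 1 : ℤ) ∣ j * (2 * n + j).choose j := by
    exact_mod_cast two_mul_succ_dvd_mul_choose n j
  obtain ⟨r, hr⟩ := two_mul_succ_dvd_choose_mul_choose n j hj
  have h := Nat.choose_succ_right_eq (3 * n) (n + j)
  rw [show 3 * n - (n + j) = 2 * n - j by omega] at h
  zify [show j ≤ 2 * n by omega] at h
  refine ⟨(3 * n).choose (n + j) * ((2 * n + j).choose j - q) - (j + 1) * r, ?_⟩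
  linear_combination (j + 1) * ((2 * n + j).choose j : ℤ) * h -
    (n + j + 1) * ((3 * n).choose (n + j) : ℤ) * hq - (n + j + 1) * (j + 1) * hr

lemma sum_F_eq_centralDiff (j m : ℕ) :
    ((2 * ((j + m : ℕ) : ℚ) + 1) * (2 * (j + m))!) ^ 2 *
      ∑ v ∈ range (2 * m + 1), ((2 * m).choose v : ℚ) * (F (j + m) (j + v) : ℚ) =
    (-1) ^ (j + m) * centralDiff m (fun x => (((j + m : ℕ) + 1 : ℚ) ^ 2 - x ^ 2) *
        evenProd (j + m) (2 * (j + m)) x) := by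
  rw [centralDiff, mul_sum, mul_sum]
  refine sum_congr rfl fun v hv => ?_
  have hv' : v ≤ 2 * m := by simpa [Nat.lt_succ_iff] using hv
  have h := mul_F_eq (j + m) (j + v) (by omega)
  rw [show (((j + v : ℕ) : ℚ) - ((j + m : ℕ) : ℚ)) = (v : ℚ) - m by push_cast; ring] at h
  have hs : (-1 : ℚ) ^ (j + v) = (-1) ^ (j + m) * (-1) ^ (v + m) := by
    rw [← pow_add, show j + m + (v + m) = (j + v) + 2 * m by ring, pow_add _ (j + v), pow_mul]; simp
  rw [hs] at h
  linear_combination ((2 * m).choose v : ℚ) * h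

lemma choose_mul_MS_zero (j m : ℕ) :
    ((2 * (j + m : ℕ) + 1) * ((j + m : ℕ) + j + 1) : ℤ) *
      ((2 * (j + m)).choose j * MS (j + m) j 0) =
    (-1) ^ (j + m) * ((2 * (j + m)).choose (j + m) : ℤ) * ((j + m).choose j : ℤ) *
      ((3 * (j + m)).choose (j + m + j) * (2 * (j + m) + j).choose j *
        (2 * (j + m : ℕ) ^ 2 + (j + m : ℕ) * (1 - j) + j + 1)) := by
  have h1 := sum_F_eq_centralDiff j m
  have h2 := centralDiff_sq_sub_mul_evenProd j m
  have h3 := centralDiff_evenProd (j + m) m (2 * j + m)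
  rw [show m + (2 * j + m) = 2 * (j + m) by ring] at h3
  have hMS : (MS (j + m) j 0 : ℚ) = ((j + 2 * m).choose j : ℚ) *
      ∑ v ∈ range (2 * m + 1), ((2 * m).choose v : ℚ) * (F (j + m) (j + v) : ℚ) := by
    rw [MS, show 2 * (j + m) - j = j + 2 * m by omega,
      show 2 * (j + m) - 2 * j = 2 * m by omega]
    simp
  have c1 : ((2 * (j + m)).choose j : ℚ) = (2 * (j + m))! / (j ! * (j + 2 * m)!) := by
    rw [show 2 * (j + m) = j + (j + 2 * m) by ring, ← Nat.cast_add_choose]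
  have c2 : ((j + 2 * m).choose j : ℚ) = (j + 2 * m)! / (j ! * (2 * m)!) := by
    rw [← Nat.cast_add_choose]
  have c3 : ((2 * (j + m)).choose (j + m) : ℚ) = (2 * (j + m))! / ((j + m)! * (j + m)!) := by
    rw [two_mul, ← Nat.cast_add_choose]
  have c4 : ((j + m).choose j : ℚ) = (j + m)! / (j ! * m !) := by
    rw [← Nat.cast_add_choose]
  have c5 : ((3 * (j + m)).choose (j + m + j) : ℚ) =
      (3 * (j + m))! / ((2 * j + m)! * (j + 2 * m)!) := by
    rw [show j + m + j = 2 * j + m by ring,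
      show 3 * (j + m) = 2 * j + m + (j + 2 * m) by ring, ← Nat.cast_add_choose]
  have c6 : ((2 * (j + m) + j).choose j : ℚ) =
      (2 * (j + m) + j)! / (j ! * (2 * (j + m))!) := by
    rw [add_comm, ← Nat.cast_add_choose]
  rw [show j + m + m + (2 * j + m) = 3 * (j + m) by ring,
    show j + m + (2 * j + m) = 2 * (j + m) + j by ring,
    show j + m + m = j + 2 * m by ring] at h3
  have key : ((2 * (j + m)).choose j : ℚ) * ((j + 2 * m).choose j : ℚ) *
      centralDiff m (evenProd (j + m) (2 * (j + m))) =
      ((2 * (j + m))! : ℚ) ^ 2 * (((2 * (j + m)).choose (j + m) : ℚ) * ((j + m).choose j : ℚ) *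
        ((3 * (j + m)).choose (j + m + j) * (2 * (j + m) + j).choose j)) := by
    rw [h3, c1, c2, c3, c4, c5, c6]
    field_simp
  have hpos : (((2 * ((j + m : ℕ) : ℚ) + 1)) * ((2 * (j + m))! : ℚ) ^ 2) ≠ 0 := by positivity
  have goal : ((2 * (j + m : ℕ) + 1) * ((j + m : ℕ) + j + 1) : ℚ) *
      ((2 * (j + m)).choose j * (MS (j + m) j 0 : ℚ)) =
    (-1) ^ (j + m) * ((2 * (j + m)).choose (j + m) : ℚ) * ((j + m).choose j : ℚ) *
      ((3 * (j + m)).choose (j + m + j) * (2 * (j + m) + j).choose j *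
        (2 * (j + m : ℕ) ^ 2 + (j + m : ℕ) * (1 - j) + j + 1)) := by
    apply mul_left_cancel₀ hpos
    rw [hMS]
    push_cast at h1 h2 ⊢
    linear_combination ((2 * (j : ℚ) + m + 1) * ((2 * (j + m)).choose j : ℚ) *
        ((j + 2 * m).choose j : ℚ)) * h1 +
      ((-1) ^ (j + m) * ((2 * (j + m)).choose j : ℚ) * ((j + 2 * m).choose j : ℚ)) * h2 +
      ((-1) ^ (j + m) * (2 * (j + m) + 1) *
        (2 * ((j : ℚ) + m) ^ 2 + (j + m) * (1 - j) + j + 1)) * key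
  exact_mod_cast goal

lemma centralBinom_dvd_choose_mul_MS_zero (n j : ℕ) (hj : j ≤ n) :
    ((2 * n).choose n : ℤ) ∣ (2 * n).choose j * MS n j 0 := by
  obtain ⟨m, rfl⟩ := Nat.exists_eq_add_of_le hj
  have h := choose_mul_MS_zero j m
  obtain ⟨q, hq⟩ := mul_dvd_choose_mul_choose_mul (j + m) j hj
  refine ⟨(-1) ^ (j + m) * (j + m).choose j * q, ?_⟩
  have hpos : ((2 * (j + m : ℕ) + 1) * ((j + m : ℕ) + j + 1) : ℤ) ≠ 0 := by positivity
  apply mul_left_cancel₀ hpos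
  rw [h, hq]
  ring

lemma MS_eq_sum_range (n j t : ℕ) (hj : j ≤ n) :
    MS n j t = ∑ k ∈ range (2 * n + 1), ((2 * n - j).choose k : ℤ) * (k.choose j : ℤ) *
      ((2 * n).choose k : ℤ) ^ t * F n k := by
  rw [MS, mul_sum, show 2 * n + 1 = j + (2 * n - 2 * j + 1 + j) by omega, sum_range_add _ j,
    sum_eq_zero (s := range j), zero_add, sum_range_add _ (2 * n - 2 * j + 1) j,
    sum_eq_zero (s := range j), add_zero]
  · refine sum_congr rfl fun v _ => ?_
    have h := Nat.choose_mul (n := 2 * n - j) (k := j + v) (s := j) (by omega)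
    rw [show 2 * n - j - j = 2 * n - 2 * j by omega, Nat.add_sub_cancel_left] at h
    zify at h
    rw [h]
    ring
  · intro v _
    rw [Nat.choose_eq_zero_of_lt (show 2 * n - j < j + (2 * n - 2 * j + 1 + v) by omega)]
    simp
  · intro k hk
    rw [Nat.choose_eq_zero_of_lt (mem_range.1 hk)]
    simp

lemma sum_choose_mul_choose (n j k : ℕ) (hj : j ≤ n) (hk : k ≤ 2 * n) :
    (2 * n - j).choose k * k.choose j * (2 * n).choose k =
      ∑ i ∈ range (n + 1), (2 * n).choose i * i.choose j * ((2 * n - i).choose k * k.choose i) := by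
  have hc : ∀ i, (2 * n).choose i * (2 * n - i).choose k =
      (2 * n).choose k * (2 * n - k).choose i := by
    intro i
    have h1 := Nat.choose_mul (n := 2 * n) (Nat.le_add_right i k)
    have h2 := Nat.choose_mul (n := 2 * n) (Nat.le_add_left k i)
    rw [Nat.add_sub_cancel_left] at h1
    rw [Nat.add_sub_cancel_right] at h2
    rw [← h1, ← h2, Nat.choose_symm_add]
  have h0 : ∑ i ∈ range (n + 1),
      (2 * n).choose i * i.choose j * ((2 * n - i).choose k * k.choose i) =
      ∑ i ∈ range (k + 1),
        (2 * n).choose i * i.choose j * ((2 * n - i).choose k * k.choose i) := by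
    rw [sum_subset (range_subset_range.2 (show n + 1 ≤ 2 * n + 1 by omega)),
      sum_subset (range_subset_range.2 (show k + 1 ≤ 2 * n + 1 by omega))]
    · intro i _ hi
      rw [Nat.choose_eq_zero_of_lt (show k < i by simpa using hi)]
      simp
    · intro i _ hi
      have hi' : n < i := by simpa using hi
      rcases lt_or_ge k i with h | h
      · rw [Nat.choose_eq_zero_of_lt h]; simp
      · rw [Nat.choose_eq_zero_of_lt (show 2 * n - i < k by omega)]; simp
  rcases lt_or_ge k j with hkj | hjk
  · rw [h0, Nat.choose_eq_zero_of_lt hkj, sum_eq_zero]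
    · simp
    · intro i hi
      rw [Nat.choose_eq_zero_of_lt (show i < j by have := mem_range.1 hi; omega)]
      simp
  · have hv := Nat.add_choose_eq (2 * n - k) (k - j) k
    rw [show 2 * n - k + (k - j) = 2 * n - j by omega,
      Nat.sum_antidiagonal_eq_sum_range_succ_mk] at hv
    rw [h0, hv, sum_mul, sum_mul]
    refine sum_congr rfl fun i hi => ?_
    have hik : i ≤ k := by simpa [Nat.lt_succ_iff] using hi
    have hd : k.choose i * i.choose j = k.choose j * (k - j).choose (k - i) := by
      rcases lt_or_ge i j with hij | hij
      · rw [Nat.choose_eq_zero_of_lt hij,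
          Nat.choose_eq_zero_of_lt (show k - j < k - i by omega), mul_zero, mul_zero]
      · rw [Nat.choose_mul hij, ← Nat.choose_symm (show i - j ≤ k - j by omega),
          show k - j - (i - j) = k - i by omega]
    calc _ = ((2 * n).choose k * (2 * n - k).choose i) *
          (k.choose j * (k - j).choose (k - i)) := by ring
      _ = _ := by rw [← hc, ← hd]; ring

lemma MS_succ (n j t : ℕ) (hj : j ≤ n) :
    MS n j (t + 1) =
      ∑ i ∈ range (n + 1), ((2 * n).choose i * i.choose j : ℤ) * MS n i t := by
  have h : ∀ i ∈ range (n + 1), ((2 * n).choose i * i.choose j : ℤ) * MS n i t =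
      ∑ k ∈ range (2 * n + 1), ((2 * n).choose i * i.choose j : ℤ) *
        (((2 * n - i).choose k : ℤ) * (k.choose i : ℤ) * ((2 * n).choose k : ℤ) ^ t * F n k) := by
    intro i hi
    rw [MS_eq_sum_range n i t (by simpa [Nat.lt_succ_iff] using hi), mul_sum]
  rw [sum_congr rfl h, sum_comm, MS_eq_sum_range n j _ hj]
  refine sum_congr rfl fun k hk => ?_
  have e := sum_choose_mul_choose n j k hj (by simpa [Nat.lt_succ_iff] using hk)
  zify at e
  calc _ = (((2 * n - j).choose k : ℤ) * k.choose j * (2 * n).choose k) *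
        (((2 * n).choose k : ℤ) ^ t * F n k) := by ring
    _ = _ := by
      rw [e, sum_mul]
      exact sum_congr rfl fun i _ => by ring

end

theorem stmt15 (n j t : ℕ) (hj : j ≤ n) (ht : 1 ≤ t) :
    (((2 * n).choose n : ℤ)) ∣ MS n j t := by
  induction t, ht using Nat.le_induction generalizing j with
  | base =>
    rw [MS_succ n j 0 hj]
    refine Finset.dvd_sum fun i hi => ?_
    have h := centralBinom_dvd_choose_mul_MS_zero n i (by simpa [Nat.lt_succ_iff] using hi)
    rw [mul_right_comm]
    exact h.mul_right _
  | succ t _ ih =>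
    rw [MS_succ n j t hj]
    exact Finset.dvd_sum fun i hi => (ih i (by simpa [Nat.lt_succ_iff] using hi)).mul_left _
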